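/- Let P₁ and P₂ be affine planes in ℝⁿ with dim P₁ ≤ dim P₂. (1) If y ∈ P₁, r > 0 and P₂ ∩ B(y,r) ≠ ∅, then ∠(P₁,P₂) ≤ (3π/2)·d^{y,r}(P₁,P₂). (2) If dim P₁ = dim P₂ = n−1 and νᵢ is a unit normal vector to Pᵢ with ν₁·ν₂ ≥ 0, then |ν₁ − ν₂| ≤ ∠(P₁,P₂). -/

import Mathlib

open Metric Set MeasureTheory Filter Module
open scoped RealInnerProductSpace Topology Pointwise ENNReal

noncomputable section

/-- `ℝⁿ` as a Euclidean space. -/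
abbrev E (n : ℕ) : Type := EuclideanSpace ℝ (Fin n)

/-- `d(A,B) = sup_{a ∈ A} inf_{b ∈ B} |a - b|`. -/
def setD {n : ℕ} (A B : Set (E n)) : ℝ := ⨆ a ∈ A, Metric.infDist a B

/-- `d^{x,r}(A,B) = (1/r) d(A ∩ B(x,r), B ∩ B(x,r))`. -/
def dxr {n : ℕ} (x : E n) (r : ℝ) (A B : Set (E n)) : ℝ :=
  (1 / r) * setD (A ∩ closedBall x r) (B ∩ closedBall x r)

/-- `D^{x,r}(A,B) = max(d^{x,r}(A,B), d^{x,r}(B,A))`. -/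
def Dxr {n : ℕ} (x : E n) (r : ℝ) (A B : Set (E n)) : ℝ :=
  max (dxr x r A B) (dxr x r B A)

/-- `d̃^{x,r}(A,B) = (1/r) d(A ∩ B(x,r), B)`. -/
def dtxr {n : ℕ} (x : E n) (r : ℝ) (A B : Set (E n)) : ℝ :=
  (1 / r) * setD (A ∩ closedBall x r) B

/-- `D̃^{x,r}(A,B) = max(d̃^{x,r}(A,B), d̃^{x,r}(B,A))`. -/
def Dtxr {n : ℕ} (x : E n) (r : ℝ) (A B : Set (E n)) : ℝ :=
  max (dtxr x r A B) (dtxr x r B A)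

/-- `C` is a cone based at `y`: `y ∈ C` and `s • (C − y) = C − y` for all `s > 0`. -/
def IsConeAt {n : ℕ} (y : E n) (C : Set (E n)) : Prop :=
  y ∈ C ∧ ∀ s : ℝ, 0 < s → s • {z : E n | y + z ∈ C} = {z : E n | y + z ∈ C}

/-- The standard KP cone `{x₄² = x₁² + x₂² + x₃²}` in `ℝⁿ`, `n ≥ 4`. -/
def stdKP (n : ℕ) (hn : 4 ≤ n) : Set (E n) :=
  {x : E n | (x ⟨3, by omega⟩) ^ 2 =
    (x ⟨0, by omega⟩) ^ 2 + (x ⟨1, by omega⟩) ^ 2 + (x ⟨2, by omega⟩) ^ 2}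

/-- `C` is a KP cone based at `y`: in some orthonormal coordinates centered at the origin,
`C − y` is the standard KP cone. -/
def IsKPCone {n : ℕ} (hn : 4 ≤ n) (y : E n) (C : Set (E n)) : Prop :=
  ∃ f : E n ≃ₗᵢ[ℝ] E n, {z : E n | y + z ∈ C} = f ⁻¹' stdKP n hn

/-- `θ^P_Σ(x,r)` : best approximation of `S` in `B(x,r)` by affine `m`-planes through `x`. -/
def thetaP {n : ℕ} (m : ℕ) (S : Set (E n)) (x : E n) (r : ℝ) : ℝ :=
  ⨅ L : {L : AffineSubspace ℝ (E n) // x ∈ L ∧ Module.finrank ℝ L.direction = m},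
    Dxr x r S (L.1 : Set (E n))

/-- `θ^C_Σ(x,r)` : best approximation of `S` in `B(x,r)` by KP cones based at `x`. -/
def thetaC {n : ℕ} (hn : 4 ≤ n) (S : Set (E n)) (x : E n) (r : ℝ) : ℝ :=
  ⨅ C : {C : Set (E n) // IsKPCone hn x C}, Dxr x r S C.1

/-- `ϑ^C_Σ(x,r)` : best approximation of `S` in `B(x,r)` by KP cones containing `x`. -/
def varthetaC {n : ℕ} (hn : 4 ≤ n) (S : Set (E n)) (x : E n) (r : ℝ) : ℝ :=
  ⨅ C : {C : Set (E n) // (∃ y, IsKPCone hn y C) ∧ x ∈ C}, Dxr x r S C.1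

/-- The angle `∠(P₁,P₂) = arcsin Γ(P₁,P₂)` between two affine planes. -/
def planeAngle {n : ℕ} (P₁ P₂ : AffineSubspace ℝ (E n)) : ℝ :=
  Real.arcsin (dxr (0 : E n) 1 (P₁.direction : Set (E n)) (P₂.direction : Set (E n)))

/-- The support of a measure. -/
def msupp {n : ℕ} (μ : Measure (E n)) : Set (E n) :=
  {x : E n | ∀ r : ℝ, 0 < r → 0 < μ (closedBall x r)}

/-- Weak convergence of a sequence of measures in the sense of Radon measures. -/
def VagueTendsto {n : ℕ} (μs : ℕ → Measure (E n)) (ν : Measure (E n)) : Prop :=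
  ∀ f : E n → ℝ, Continuous f → HasCompactSupport f →
    Tendsto (fun i => ∫ y, f y ∂(μs i)) atTop (nhds (∫ y, f y ∂ν))

/-- `ν` is a tangent measure of `μ` at `x`: `ν ≠ 0` and for some `rᵢ ↓ 0`, `cᵢ > 0`,
`cᵢ (T_{x,rᵢ})₊μ → ν` weakly. -/
def IsTangentMeasure {n : ℕ} (μ ν : Measure (E n)) (x : E n) : Prop :=
  ν ≠ 0 ∧ ∃ r c : ℕ → ℝ, (∀ i, 0 < r i) ∧ Tendsto r atTop (nhds 0) ∧ (∀ i, 0 < c i) ∧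
    VagueTendsto (fun i => ENNReal.ofReal (c i) • Measure.map (fun y => (r i)⁻¹ • (y - x)) μ) ν

/-- `μ` is `m`-asymptotically optimally doubling. -/
def AOD {n : ℕ} (m : ℕ) (μ : Measure (E n)) : Prop :=
  ∀ K : Set (E n), K ⊆ msupp μ → IsCompact K → ∀ δ : ℝ, 0 < δ →
    ∃ r₀ : ℝ, 0 < r₀ ∧ ∀ x ∈ K, ∀ r : ℝ, 0 < r → r ≤ r₀ →
      ∀ τ : ℝ, τ ∈ Set.Icc (1/2 : ℝ) 1 →
        |(μ (closedBall x (τ * r))).toReal / (μ (closedBall x r)).toReal - τ ^ m| < δ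

/-- `ν` is `m`-flat: `m`-dimensional Hausdorff measure restricted to an affine `m`-plane. -/
def IsFlatMeasure {n : ℕ} (m : ℕ) (ν : Measure (E n)) : Prop :=
  ∃ L : AffineSubspace ℝ (E n), (L : Set (E n)).Nonempty ∧
    Module.finrank ℝ L.direction = m ∧
    ν = (Measure.hausdorffMeasure (m : ℝ)).restrict (L : Set (E n))

/-- Volume of the unit ball in `ℝᵐ`. -/
def unitBallVol (m : ℕ) : ℝ := (volume (Metric.ball (0 : EuclideanSpace ℝ (Fin m)) 1)).toReal

/-- `ω₃`, the volume of the unit `3`-ball. -/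
def omega3 : ℝ := unitBallVol 3

/-- The second moment `Q_{0,r}` of a measure on `ℝ⁴`. -/
def Qmom (μ : Measure (E 4)) (r : ℝ) (z : E 4) : ℝ :=
  (5 / (omega3 * r ^ 5)) * ∫ w in closedBall (0 : E 4) r, ⟪z, w⟫ ^ 2 ∂μ

/-- Entries `q_{ij}` of the second moment matrix in given directions. -/
def qmom (μ : Measure (E 4)) (r : ℝ) (u v : E 4) : ℝ :=
  (5 / (omega3 * r ^ 5)) * ∫ w in closedBall (0 : E 4) r, ⟪u, w⟫ * ⟪v, w⟫ ∂μ

/-- `μ` is `(α,m)`-Hölder asymptotically uniform. -/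
def HolderAsympUniform {n : ℕ} (α : ℝ) (m : ℕ) (μ : Measure (E n)) : Prop :=
  ∀ K : Set (E n), K ⊆ msupp μ → IsCompact K →
    ∃ C r₀ : ℝ, 0 < r₀ ∧ ∀ x ∈ K, ∀ r : ℝ, 0 < r → r ≤ r₀ →
      |(μ (closedBall x r)).toReal / (unitBallVol m * r ^ m) - 1| ≤ C * r ^ α

/-- `φ` is a `C^{1,β}` diffeomorphism from `U` onto `U'`: a continuously differentiable bijection
with `β`-Hölder derivative whose inverse is also `C^{1,β}`. -/
def IsC1HolderDiffeoOn (β : ℝ) (U U' : Set (E 4)) (φ : E 4 → E 4) : Prop :=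
  Set.BijOn φ U U' ∧
  (∀ x ∈ U, HasFDerivAt φ (fderiv ℝ φ x) x) ∧
  (∃ M : ℝ, ∀ x ∈ U, ∀ y ∈ U, ‖fderiv ℝ φ x - fderiv ℝ φ y‖ ≤ M * ‖x - y‖ ^ β) ∧
  ∃ ψ : E 4 → E 4, Set.BijOn ψ U' U ∧
    (∀ x ∈ U, ψ (φ x) = x) ∧ (∀ y ∈ U', φ (ψ y) = y) ∧
    (∀ y ∈ U', HasFDerivAt ψ (fderiv ℝ ψ y) y) ∧
    (∃ M : ℝ, ∀ x ∈ U', ∀ y ∈ U', ‖fderiv ℝ ψ x - fderiv ℝ ψ y‖ ≤ M * ‖x - y‖ ^ β)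

lemma setD_le_aux {n : ℕ} {A B : Set (E n)} {c : ℝ} (hc : 0 ≤ c)
    (h : ∀ a ∈ A, Metric.infDist a B ≤ c) : setD A B ≤ c :=
  Real.iSup_le (fun a => Real.iSup_le (fun ha => h a ha) hc) hc

lemma infDist_le_aux {n : ℕ} {A B : Set (E n)} {x : E n} {r : ℝ}
    (hB : (B ∩ closedBall x r).Nonempty) {a : E n} (ha : a ∈ A ∩ closedBall x r) :
    Metric.infDist a (B ∩ closedBall x r) ≤ 2 * r := by
  obtain ⟨b, hb⟩ := hB
  have h1 := Metric.infDist_le_dist_of_mem (x := a) hb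
  have h2 := dist_triangle_right a b x
  have h3 := mem_closedBall.1 ha.2
  have h4 := mem_closedBall.1 hb.2
  linarith

lemma le_setD_aux {n : ℕ} {A B : Set (E n)} {x : E n} {r : ℝ}
    (hB : (B ∩ closedBall x r).Nonempty) (hr : 0 ≤ r) {a : E n} (ha : a ∈ A ∩ closedBall x r) :
    Metric.infDist a (B ∩ closedBall x r) ≤
      setD (A ∩ closedBall x r) (B ∩ closedBall x r) := by
  unfold setD
  have hb : BddAbove (Set.range fun a => ⨆ _ : a ∈ A ∩ closedBall x r,
      Metric.infDist a (B ∩ closedBall x r)) := by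
    refine ⟨2 * r, ?_⟩
    rintro _ ⟨a, rfl⟩
    exact Real.iSup_le (fun ha => infDist_le_aux hB ha) (by linarith)
  refine le_trans ?_ (le_ciSup hb a)
  simp [ha]

lemma setD_nonneg_aux {n : ℕ} (A B : Set (E n)) : 0 ≤ setD A B :=
  Real.iSup_nonneg fun _ => Real.iSup_nonneg fun _ => Metric.infDist_nonneg

lemma arcsin_le_aux {x : ℝ} (h0 : 0 ≤ x) (h1 : x ≤ 1) :
    Real.arcsin x ≤ Real.pi / 2 * x := by
  have hp := Real.pi_pos
  have h := Real.mul_le_sin (Real.arcsin_nonneg.2 h0) (Real.arcsin_le_pi_div_two x)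
  rw [Real.sin_arcsin (by linarith) h1, div_mul_eq_mul_div, div_le_iff₀ hp] at h
  linarith

lemma part_one_aux {n : ℕ} (P₁ P₂ : AffineSubspace ℝ (E n)) (y : E n) (hy : y ∈ P₁) (r : ℝ)
    (hr : 0 < r) (hne : ((P₂ : Set (E n)) ∩ closedBall y r).Nonempty) :
    planeAngle P₁ P₂ ≤ (3 * Real.pi / 2) * dxr y r (P₁ : Set (E n)) (P₂ : Set (E n)) := by
  have hp := Real.pi_pos
  set s := setD ((P₁ : Set (E n)) ∩ closedBall y r) ((P₂ : Set (E n)) ∩ closedBall y r) with hs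
  have hs0 : 0 ≤ s := setD_nonneg_aux _ _
  have hcl : IsCompact ((P₂ : Set (E n)) ∩ closedBall y r) :=
    (isCompact_closedBall y r).inter_left (AffineSubspace.closed_of_finiteDimensional P₂)
  have key : ∀ a ∈ (P₁ : Set (E n)) ∩ closedBall y r,
      ∃ b ∈ P₂, dist a b ≤ s := by
    intro a ha
    obtain ⟨b, hb, hb'⟩ := hcl.exists_infDist_eq_dist hne a
    exact ⟨b, hb.1, hb' ▸ le_setD_aux hne hr.le ha⟩
  have h0mem : (0 : E n) ∈ (P₂.direction : Set (E n)) ∩ closedBall 0 1 := by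
    simp
  have hG : ∀ v ∈ (P₁.direction : Set (E n)) ∩ closedBall (0 : E n) 1,
      Metric.infDist v ((P₂.direction : Set (E n)) ∩ closedBall 0 1) ≤ 2 * s / r := by
    rintro v ⟨hv, hv1⟩
    rw [mem_closedBall_zero_iff] at hv1
    obtain ⟨q, hq, hqd⟩ := key y ⟨hy, by simp [hr.le]⟩
    obtain ⟨p, hp, hpd⟩ := key (r • v + y) ⟨by
      exact AffineSubspace.vadd_mem_of_mem_direction (P₁.direction.smul_mem r hv) hy, by
      rw [mem_closedBall, dist_eq_norm, add_sub_cancel_right, norm_smul, Real.norm_of_nonneg hr.le]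
      nlinarith⟩
    have hpq : p - q ∈ P₂.direction := AffineSubspace.vsub_mem_direction hp hq
    have hw : r⁻¹ • (p - q) ∈ P₂.direction := P₂.direction.smul_mem _ hpq
    have hproj : P₂.direction.starProjection v ∈
        (P₂.direction : Set (E n)) ∩ closedBall (0 : E n) 1 :=
      ⟨Submodule.starProjection_apply_mem _ _, by
        rw [mem_closedBall_zero_iff]
        exact (Submodule.norm_starProjection_apply_le _ v).trans hv1⟩
    refine (Metric.infDist_le_dist_of_mem hproj).trans ?_
    rw [dist_eq_norm]
    have hmin : ‖v - P₂.direction.starProjection v‖ ≤ ‖v - r⁻¹ • (p - q)‖ := by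
      rw [Submodule.starProjection_minimal]
      exact ciInf_le ⟨0, by rintro _ ⟨_, rfl⟩; positivity⟩
        (⟨_, hw⟩ : (P₂.direction : Submodule ℝ (E n)))
    refine hmin.trans ?_
    have e : v - r⁻¹ • (p - q) = r⁻¹ • ((r • v + y - p) - (y - q)) := by
      rw [show (r • v + y - p) - (y - q) = r • v - (p - q) by abel, smul_sub r⁻¹ (r • v),
        inv_smul_smul₀ hr.ne']
    rw [e, norm_smul, norm_inv, Real.norm_of_nonneg hr.le, div_eq_inv_mul]
    have := norm_sub_le (r • v + y - p) (y - q)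
    rw [dist_eq_norm] at hpd hqd
    gcongr
    linarith
  unfold planeAngle dxr
  rw [← hs, one_div_one, one_mul]
  have hG2 := setD_le_aux (by positivity) hG
  have hG1 : setD ((P₁.direction : Set (E n)) ∩ closedBall (0 : E n) 1)
      ((P₂.direction : Set (E n)) ∩ closedBall 0 1) ≤ 1 := by
    refine setD_le_aux zero_le_one fun a ha => ?_
    exact (Metric.infDist_le_dist_of_mem h0mem).trans (mem_closedBall.1 ha.2)
  refine (arcsin_le_aux (setD_nonneg_aux _ _) hG1).trans ?_
  refine (mul_le_mul_of_nonneg_left hG2 (by positivity)).trans ?_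
  have : 0 ≤ Real.pi * (s / r) := by positivity
  have e : (3 * Real.pi / 2) * (1 / r * s) = 3 / 2 * (Real.pi * (s / r)) := by ring
  have e2 : Real.pi / 2 * (2 * s / r) = Real.pi * (s / r) := by ring
  rw [e, e2]; linarith

lemma part_two_aux {n : ℕ} (V₁ V₂ : Submodule ℝ (E n))
    (hd : Module.finrank ℝ V₁ = n - 1) (ν₁ ν₂ : E n) (h1 : ‖ν₁‖ = 1) (h2 : ‖ν₂‖ = 1)
    (hv1 : ∀ v ∈ V₁, ⟪ν₁, v⟫ = 0) (hv2 : ∀ v ∈ V₂, ⟪ν₂, v⟫ = 0) (hc : 0 ≤ ⟪ν₁, ν₂⟫) :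
    ‖ν₁ - ν₂‖ ≤ Real.arcsin (dxr (0 : E n) 1 (V₁ : Set (E n)) (V₂ : Set (E n))) := by
  have hne : ν₁ ≠ 0 := by rintro rfl; simp at h1
  have hV : V₁ = (Submodule.span ℝ {ν₁})ᗮ := by
    apply Submodule.eq_of_le_of_finrank_eq
    · intro v hv
      rw [Submodule.mem_orthogonal_singleton_iff_inner_right]
      exact hv1 v hv
    · have a := Submodule.finrank_add_finrank_orthogonal (Submodule.span ℝ {ν₁})
      rw [finrank_span_singleton hne, finrank_euclideanSpace_fin] at a
      omega
  set c : ℝ := ⟪ν₁, ν₂⟫ with hcdef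
  have hc1 : c ≤ 1 := by
    have := real_inner_le_norm ν₁ ν₂
    rwa [h1, h2, one_mul] at this
  have i1 : ⟪ν₁, ν₁⟫ = 1 := by rw [real_inner_self_eq_norm_sq, h1]; norm_num
  have i2 : ⟪ν₂, ν₂⟫ = 1 := by rw [real_inner_self_eq_norm_sq, h2]; norm_num
  have i3 : ⟪ν₂, ν₁⟫ = c := real_inner_comm _ _
  have h0mem : ((V₂ : Set (E n)) ∩ closedBall 0 1).Nonempty := ⟨0, by simp⟩
  set w := ν₂ - c • ν₁ with hw
  have hwV : w ∈ V₁ := by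
    rw [hV, Submodule.mem_orthogonal_singleton_iff_inner_right, hw, inner_sub_right,
      inner_smul_right, i1, ← hcdef]
    ring
  have hww : ⟪ν₂, w⟫ = 1 - c ^ 2 := by
    rw [hw, inner_sub_right, inner_smul_right, i2, i3]; ring
  have hwn : ‖w‖ ^ 2 = 1 - c ^ 2 := by
    rw [← real_inner_self_eq_norm_sq, hw, inner_sub_left, ← hw, hww, inner_smul_left,
      hv1 w hwV]
    simp
  have hG : ‖w‖ ≤ dxr (0 : E n) 1 (V₁ : Set (E n)) (V₂ : Set (E n)) := by
    unfold dxr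
    rw [one_div_one, one_mul]
    by_cases hz : ‖w‖ = 0
    · rw [hz]; exact setD_nonneg_aux _ _
    have hu : ‖w‖⁻¹ • w ∈ (V₁ : Set (E n)) ∩ closedBall (0 : E n) 1 := by
      refine ⟨V₁.smul_mem _ hwV, ?_⟩
      rw [mem_closedBall_zero_iff, norm_smul, norm_inv, norm_norm, inv_mul_cancel₀ hz]
    refine le_trans ?_ (le_setD_aux h0mem zero_le_one hu)
    rw [Metric.le_infDist h0mem]
    intro b hb
    rw [dist_eq_norm]
    have := real_inner_le_norm ν₂ (‖w‖⁻¹ • w - b)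
    rw [h2, one_mul, inner_sub_right, inner_smul_right, hww, hv2 b hb.1, ← hwn, sub_zero, pow_two,
      inv_mul_cancel_left₀ hz] at this
    exact this
  refine le_trans ?_ (Real.monotone_arcsin hG)
  have hwe : ‖w‖ = √(1 - c ^ 2) := by rw [← hwn, Real.sqrt_sq (norm_nonneg _)]
  rw [hwe, ← Real.arccos_eq_arcsin hc]
  have hcos := Real.one_sub_sq_div_two_le_cos (x := Real.arccos c)
  rw [Real.cos_arccos (by linarith) hc1] at hcos
  refine le_of_sq_le_sq ?_ (Real.arccos_nonneg c)
  rw [norm_sub_sq_real, h1, h2, ← hcdef]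
  linarith

/-- Lemma 2.5 on the geometry of planes: (1) the angle between two planes
is controlled by the one–sided relative Hausdorff distance; (2) the distance between
compatible unit normals of two hyperplanes is at most the angle between them. -/
theorem plane_geometry {n : ℕ} (P₁ P₂ : AffineSubspace ℝ (E n))
    (h₁ : (P₁ : Set (E n)).Nonempty) (h₂ : (P₂ : Set (E n)).Nonempty)
    (hdim : Module.finrank ℝ P₁.direction ≤ Module.finrank ℝ P₂.direction) :
    (∀ y ∈ P₁, ∀ r : ℝ, 0 < r → ((P₂ : Set (E n)) ∩ closedBall y r).Nonempty →
      planeAngle P₁ P₂ ≤ (3 * Real.pi / 2) * dxr y r (P₁ : Set (E n)) (P₂ : Set (E n))) ∧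
    (Module.finrank ℝ P₁.direction = n - 1 → Module.finrank ℝ P₂.direction = n - 1 →
      ∀ ν₁ ν₂ : E n, ‖ν₁‖ = 1 → ‖ν₂‖ = 1 →
        (∀ v ∈ P₁.direction, ⟪ν₁, v⟫ = 0) → (∀ v ∈ P₂.direction, ⟪ν₂, v⟫ = 0) →
        0 ≤ ⟪ν₁, ν₂⟫ → ‖ν₁ - ν₂‖ ≤ planeAngle P₁ P₂) := by
  exact ⟨fun y hy r hr hne => part_one_aux P₁ P₂ y hy r hr hne,
    fun hd _ ν₁ ν₂ h1 h2 hv1 hv2 hc =>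
      part_two_aux P₁.direction P₂.direction hd ν₁ ν₂ h1 h2 hv1 hv2 hc⟩
end
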